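/- With the weighted-homogeneous isolated-singularity setup, the Hilbert function of the graded Milnor algebra is symmetric about half the socle degree: for every integer k with 0 ≤ k ≤ n·d − 2·Σᵢdᵢ one has dim_ℂ Q_k = dim_ℂ Q_{(n·d − 2·Σᵢdᵢ) − k}. -/

import Mathlib

open MvPolynomial

/-- The Jacobian ideal of `f`, generated by its partial derivatives. -/
noncomputable def jacobianIdeal (n : ℕ) (f : MvPolynomial (Fin n) ℂ) :
    Ideal (MvPolynomial (Fin n) ℂ) :=
  Ideal.span (Set.range fun i => pderiv i f)

/-- The degree-`k` graded piece of the Milnor algebra `Q = ℂ[x]/J(f)` with respect to the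
weighted grading `w`: the image in `Q` of the weighted homogeneous polynomials of degree `k`. -/
noncomputable def milnorPiece (n : ℕ) (w : Fin n → ℕ) (f : MvPolynomial (Fin n) ℂ) (k : ℕ) :
    Submodule ℂ (MvPolynomial (Fin n) ℂ ⧸ jacobianIdeal n f) :=
  (weightedHomogeneousSubmodule ℂ w k).map
    (Ideal.Quotient.mkₐ ℂ (jacobianIdeal n f)).toLinearMap

open RingTheory.Sequence in
theorem exists_mem_ofList_forall_add_mem_imp (k : Type*) {A : Type*} [Field k] [Infinite k]
    [CommRing A] [Algebra k A] {S : Set (Ideal A)} (hS : S.Finite) (y : A) (bs : List A) :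
    ∃ z ∈ Ideal.ofList bs, ∀ P ∈ S, y + z ∈ P → y ∈ P ∧ ∀ b ∈ bs, b ∈ P := by
  induction bs generalizing y with
  | nil => exact ⟨0, zero_mem _, by simp⟩
  | cons b bs ih =>
    obtain ⟨c, hc⟩ : ∃ c : k, ∀ P ∈ S, y + algebraMap k A c * b ∈ P → y ∈ P ∧ b ∈ P := by
      let bad (P : Ideal A) : Set k := {c | y + algebraMap k A c * b ∈ P ∧ ¬ (y ∈ P ∧ b ∈ P)}
      have hbad : (⋃ P ∈ S, bad P).Finite := by
        refine hS.biUnion fun P hPS => Set.Subsingleton.finite ?_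
        rintro c ⟨hc, hn⟩ c' ⟨hc', -⟩
        by_contra hne
        have hunit : IsUnit (algebraMap k A (c - c')) :=
          (IsUnit.mk0 _ (sub_ne_zero.mpr hne)).map _
        have hb : b ∈ P := by
          have h := P.sub_mem hc hc'
          rw [add_sub_add_left_eq_sub, ← sub_mul, ← map_sub] at h
          exact (Ideal.unit_mul_mem_iff_mem P hunit).mp h
        exact hn ⟨(P.add_mem_iff_left (P.mul_mem_left _ hb)).mp hc, hb⟩
      obtain ⟨c, hc⟩ := hbad.infinite_compl.nonempty
      refine ⟨c, fun P hPS h => ?_⟩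
      by_contra hn
      exact hc (Set.mem_biUnion hPS ⟨h, hn⟩)
    obtain ⟨z, hz, h⟩ := ih (y + algebraMap k A c * b)
    refine ⟨algebraMap k A c * b + z, ?_, fun P hPS hmem => ?_⟩
    · rw [Ideal.ofList_cons]
      exact Submodule.add_mem_sup (Ideal.mul_mem_left _ _ (Ideal.mem_span_singleton_self b)) hz
    · rw [← add_assoc] at hmem
      obtain ⟨h₁, h₂⟩ := h P hPS hmem
      obtain ⟨h₃, h₄⟩ := hc P hPS h₁
      exact ⟨h₃, List.forall_mem_cons.mpr ⟨h₄, h₂⟩⟩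

open RingTheory.Sequence IsLocalRing in
theorem isWeaklyRegular_of_maximalIdeal_le_radical (k : Type*) {A : Type*} [Field k] [Infinite k]
    [CommRing A] [Algebra k A] [IsLocalRing A] [IsNoetherianRing A] (bs : List A)
    (hb : ∀ b ∈ bs, b ∈ maximalIdeal A) {M : Type*} [AddCommGroup M] [Module A M]
    [Module.Finite A M]
    (hrad : maximalIdeal A ≤ (Ideal.ofList bs ⊔ Module.annihilator A M).radical)
    (as : List A) (ha : ∀ a ∈ as, a ∈ maximalIdeal A) (hlen : as.length = bs.length)
    (has : IsWeaklyRegular M as) : IsWeaklyRegular M bs := by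
  induction bs generalizing M as with
  | nil => exact .nil A M
  | cons b bs ih =>
    obtain ⟨as, a, rfl⟩ : ∃ as' a, as = as' ++ [a] :=
      ⟨as.dropLast, as.getLast (by rintro rfl; simp at hlen),
        (List.dropLast_append_getLast _).symm⟩
    simp only [List.length_append, List.length_cons, List.length_nil, zero_add,
      add_left_inj] at hlen
    rw [isWeaklyRegular_append_iff, isWeaklyRegular_singleton_iff] at has
    obtain ⟨has, hareg⟩ := has
    set N := M ⧸ (Ideal.ofList as • ⊤ : Submodule A M) with hN
    obtain ⟨z, hz, havoid⟩ :=
      exists_mem_ofList_forall_add_mem_imp k (associatedPrimes.finite A N) b bs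
    have hann : Module.annihilator A M ≤ Module.annihilator A N :=
      LinearMap.annihilator_le_of_surjective _ (Submodule.mkQ_surjective _)
    have hyreg : IsSMulRegular N (b + z) := by
      by_contra hnot
      have hmem : b + z ∈ ⋃ P ∈ associatedPrimes A N, (P : Set A) := by
        rw [biUnion_associatedPrimes_eq_compl_regular]
        exact hnot
      have hmema : a ∉ ⋃ P ∈ associatedPrimes A N, (P : Set A) := by
        rw [biUnion_associatedPrimes_eq_compl_regular]
        exact fun h => h hareg
      simp only [Set.mem_iUnion, exists_prop] at hmem hmema
      obtain ⟨P, hP, hyP⟩ := hmem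
      have hPp : P.IsPrime := IsAssociatedPrime.isPrime hP
      have hbP := havoid P hP hyP
      refine hmema ⟨P, hP, ?_⟩
      have hle : maximalIdeal A ≤ P := by
        refine hrad.trans (hPp.radical_le_iff.mpr (sup_le ?_ ?_))
        · exact Ideal.span_le.mpr (List.forall_mem_cons.mpr hbP)
        · exact hann.trans (Submodule.annihilator_top (R := A) (M := N) ▸
            IsAssociatedPrime.annihilator_le hP)
      exact hle (ha a (by simp))
    rw [List.forall_mem_cons] at hb
    have hbs : Ideal.ofList bs ≤ maximalIdeal A := Ideal.span_le.mpr hb.2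
    have hym : b + z ∈ maximalIdeal A := add_mem hb.1 (hbs hz)
    have ham : ∀ a ∈ as, a ∈ maximalIdeal A := fun a h => ha a (by simp [h])
    have hyas : IsWeaklyRegular M ((b + z) :: as) := by
      refine isWeaklyRegular_of_perm_of_subset_maximalIdeal
        (rs := as ++ [b + z]) ?_ (List.perm_append_singleton _ _) ?_
      · rw [isWeaklyRegular_append_iff, isWeaklyRegular_singleton_iff]
        exact ⟨has, hyreg⟩
      · simp only [List.mem_append, List.mem_singleton]
        rintro r (h | rfl)
        exacts [ham r h, hym]
    rw [isWeaklyRegular_cons_iff] at hyas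
    have hquot : IsWeaklyRegular (QuotSMulTop (b + z) M) bs := by
      refine ih hb.2 (hrad.trans (Ideal.radical_mono (sup_le ?_ ?_))) as ham hlen hyas.2
      · have hbsle : Ideal.ofList bs ≤
            Ideal.ofList bs ⊔ Module.annihilator A (QuotSMulTop (b + z) M) := le_sup_left
        have hy : b + z ∈ Module.annihilator A (QuotSMulTop (b + z) M) :=
          Module.mem_annihilator.mpr fun m => by
            obtain ⟨m, rfl⟩ := Submodule.mkQ_surjective _ m
            rw [← map_smul]
            exact (Submodule.Quotient.mk_eq_zero _).mpr
              (Submodule.smul_mem_pointwise_smul _ _ _ trivial)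
        rw [Ideal.ofList_cons, sup_le_iff, Ideal.span_singleton_le_iff_mem]
        refine ⟨?_, hbsle⟩
        exact (Ideal.add_mem_iff_left _ (hbsle hz)).mp (Ideal.mem_sup_right hy)
      · exact (LinearMap.annihilator_le_of_surjective _
          (Submodule.mkQ_surjective _)).trans le_sup_right
    have hbsy : IsWeaklyRegular M (bs ++ [b + z]) := by
      refine isWeaklyRegular_of_perm_of_subset_maximalIdeal
        ((isWeaklyRegular_cons_iff M _ _).mpr ⟨hyas.1, hquot⟩)
        (List.perm_append_singleton _ _).symm ?_
      exact List.forall_mem_cons.mpr ⟨hym, hb.2⟩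
    refine isWeaklyRegular_of_perm_of_subset_maximalIdeal (rs := bs ++ [b]) ?_
      (List.perm_append_singleton _ _) ?_
    · rw [isWeaklyRegular_append_iff, isWeaklyRegular_singleton_iff] at hbsy ⊢
      refine ⟨hbsy.1, fun m m' h => hbsy.2 ?_⟩
      have hz0 (m : M ⧸ (Ideal.ofList bs • ⊤ : Submodule A M)) : z • m = 0 := by
        obtain ⟨m, rfl⟩ := Submodule.mkQ_surjective _ m
        rw [← map_smul]
        exact (Submodule.Quotient.mk_eq_zero _).mpr (Submodule.smul_mem_smul hz trivial)
      simpa [add_smul, hz0] using h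
    · simp only [List.mem_append, List.mem_singleton]
      rintro r (h | rfl)
      exacts [hb.2 r h, hb.1]

open RingTheory.Sequence in
theorem isWeaklyRegular_ofFn_iff {A : Type*} [CommRing A] {n : ℕ} (g : Fin n → A) :
    IsWeaklyRegular A (List.ofFn g) ↔
      ∀ i h, g i * h ∈ Ideal.span (g '' Set.Iio i) → h ∈ Ideal.span (g '' Set.Iio i) := by
  have htake (i : Fin n) : Ideal.ofList ((List.ofFn g).take i) = Ideal.span (g '' Set.Iio i) := by
    refine congrArg Ideal.span (Set.ext fun x => ?_)
    simp only [Set.mem_ofPred_eq, List.mem_take_iff_getElem, Set.mem_image, Set.mem_Iio]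
    constructor
    · rintro ⟨j, hj, rfl⟩
      simp only [List.length_ofFn, lt_inf_iff] at hj
      exact ⟨⟨j, hj.2⟩, hj.1, by simp⟩
    · rintro ⟨j, hj, rfl⟩
      exact ⟨j, by simp only [List.length_ofFn, lt_inf_iff]; exact ⟨hj, j.2⟩, by simp⟩
  rw [isWeaklyRegular_iff_Fin, ← (finCongr (List.length_ofFn (f := g))).symm.forall_congr_right]
  refine forall_congr' fun i => ?_
  rw [isSMulRegular_iff_right_eq_zero_of_smul]
  rw [(Submodule.mkQ_surjective _).forall]
  refine forall_congr' fun x => ?_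
  rw [← map_smul, Submodule.mkQ_apply, Submodule.mkQ_apply, Submodule.Quotient.mk_eq_zero,
    Submodule.Quotient.mk_eq_zero]
  simp [htake]

section WeightedHilbert

variable {K : Type*} [Field K] {n : ℕ} {w : Fin n → ℕ}

theorem X_mul_mem_span_X_image_iff {σ : Type*} {s : Set σ} {i : σ} (hi : i ∉ s)
    (h : MvPolynomial σ K) :
    X i * h ∈ Ideal.span (X '' s : Set (MvPolynomial σ K)) ↔
      h ∈ Ideal.span (X '' s : Set (MvPolynomial σ K)) := by
  refine ⟨fun hmem => ?_, fun hmem => Ideal.mul_mem_left _ _ hmem⟩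
  rw [mem_ideal_span_X_image] at hmem ⊢
  intro m hm
  obtain ⟨j, hj, hne⟩ := hmem (Finsupp.single i 1 + m) (by
    rw [mem_support_iff, coeff_X_mul]
    exact mem_support_iff.mp hm)
  have hij : i ≠ j := by rintro rfl; exact hi hj
  exact ⟨j, hj, by simpa [Finsupp.single_apply, hij] using hne⟩

theorem span_range_X_eq_ker_constantCoeff :
    Ideal.span (Set.range (X : Fin n → MvPolynomial (Fin n) K)) =
      RingHom.ker (constantCoeff (R := K) (σ := Fin n)) := by
  ext p
  rw [← Set.image_univ, mem_ideal_span_X_image, RingHom.mem_ker, constantCoeff_eq]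
  constructor
  · intro h
    by_contra hne
    simpa using h 0 (mem_support_iff.mpr hne)
  · intro h m hm
    by_contra! hzero
    have : m = 0 := Finsupp.ext fun i => by simpa using hzero i
    rw [mem_support_iff, this] at hm
    exact hm h

theorem constantCoeff_eq_zero_of_isWeightedHomogeneous {p : MvPolynomial (Fin n) K} {c : ℕ}
    (hp : IsWeightedHomogeneous w p c) (hc : 0 < c) : constantCoeff p = 0 := by
  rw [constantCoeff_eq]
  exact hp.coeff_eq_zero 0 (by simpa using hc.ne)

attribute [local instance] MvPolynomial.weightedGradedAlgebra in
theorem weightedHomogeneousComponent_mem_span {ι : Type*} {g : ι → MvPolynomial (Fin n) K}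
    {c : ι → ℕ} (hg : ∀ i, IsWeightedHomogeneous w (g i) (c i)) {s : Set ι}
    {p : MvPolynomial (Fin n) K} (hp : p ∈ Ideal.span (g '' s)) (k : ℕ) :
    weightedHomogeneousComponent w k p ∈ Ideal.span (g '' s) := by
  refine weightedHomogeneousComponent_mem_of_mem K w (Ideal.homogeneous_span _ _ ?_) hp k
  rintro _ ⟨i, -, rfl⟩
  exact ⟨c i, hg i⟩

attribute [local instance] MvPolynomial.weightedGradedAlgebra in
theorem weightedHomogeneousComponent_mul_of_le {p : MvPolynomial (Fin n) K} {c : ℕ}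
    (hp : IsWeightedHomogeneous w p c) (q : MvPolynomial (Fin n) K) {k : ℕ} (hk : c ≤ k) :
    weightedHomogeneousComponent w k (p * q) =
      p * weightedHomogeneousComponent w (k - c) q := by
  have h := DirectSum.coe_decompose_mul_of_left_mem_of_le (weightedHomogeneousSubmodule K w)
    (b := q) hp hk
  simp only [← weightedDecomposition.decompose'_apply]
  exact h

attribute [local instance] MvPolynomial.weightedGradedAlgebra in
theorem weightedHomogeneousComponent_mul_of_lt {p : MvPolynomial (Fin n) K} {c : ℕ}
    (hp : IsWeightedHomogeneous w p c) (q : MvPolynomial (Fin n) K) {k : ℕ} (hk : k < c) :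
    weightedHomogeneousComponent w k (p * q) = 0 := by
  have h := DirectSum.coe_decompose_mul_of_left_mem_of_not_le (weightedHomogeneousSubmodule K w)
    (b := q) hp hk.not_ge
  simp only [← weightedDecomposition.decompose'_apply]
  exact h

open RingTheory.Sequence in
theorem mem_span_image_Iio_of_mul_mem [Infinite K] (hw : ∀ i, 0 < w i)
    {g : Fin n → MvPolynomial (Fin n) K} {c : Fin n → ℕ} (hc : ∀ i, 0 < c i)
    (hg : ∀ i, IsWeightedHomogeneous w (g i) (c i))
    (hrad : RingHom.ker (constantCoeff (R := K) (σ := Fin n)) ≤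
      (Ideal.span (Set.range g)).radical)
    (i : Fin n) (h : MvPolynomial (Fin n) K) (hmem : g i * h ∈ Ideal.span (g '' Set.Iio i)) :
    h ∈ Ideal.span (g '' Set.Iio i) := by
  set 𝔪 := RingHom.ker (constantCoeff (R := K) (σ := Fin n)) with h𝔪
  have hprime : 𝔪.IsPrime := RingHom.ker_isPrime _
  let L := Localization.AtPrime 𝔪
  have hmax : IsLocalRing.maximalIdeal L = 𝔪.map (algebraMap (MvPolynomial (Fin n) K) L) :=
    Localization.AtPrime.map_eq_maximalIdeal.symm
  have hmap {p : MvPolynomial (Fin n) K} (hp : p ∈ 𝔪) :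
      algebraMap _ L p ∈ IsLocalRing.maximalIdeal L := hmax ▸ Ideal.mem_map_of_mem _ hp
  have hX : IsWeaklyRegular (MvPolynomial (Fin n) K) (List.ofFn X) :=
    (isWeaklyRegular_ofFn_iff _).mpr fun i h =>
      (X_mul_mem_span_X_image_iff Set.self_notMem_Iio h).mp
  have hL : IsWeaklyRegular L ((List.ofFn g).map (algebraMap _ L)) := by
    refine isWeaklyRegular_of_maximalIdeal_le_radical K _ ?_ ?_ _ ?_ ?_
      (IsWeaklyRegular.of_isLocalization L 𝔪.primeCompl hX)
    · simp only [List.mem_map, List.mem_ofFn', Set.mem_range]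
      rintro _ ⟨_, ⟨i, rfl⟩, rfl⟩
      exact hmap (constantCoeff_eq_zero_of_isWeightedHomogeneous (hg i) (hc i))
    · rw [hmax]
      refine (Ideal.map_mono hrad).trans ((Ideal.map_radical_le _).trans
        (Ideal.radical_mono (le_sup_of_le_left ?_)))
      rw [← Ideal.map_ofList]
      refine Ideal.map_mono (Ideal.span_mono fun p hp => ?_)
      simpa [List.mem_ofFn'] using hp
    · simp only [List.mem_map, List.mem_ofFn', Set.mem_range]
      rintro _ ⟨_, ⟨i, rfl⟩, rfl⟩
      exact hmap (by simp [h𝔪])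
    · simp
  rw [List.map_ofFn, isWeaklyRegular_ofFn_iff] at hL
  have hspan : Ideal.span ((algebraMap _ L ∘ g) '' Set.Iio i) =
      (Ideal.span (g '' Set.Iio i)).map (algebraMap _ L) := by
    rw [Ideal.map_span, Set.image_comp]
  have hcomp {p : MvPolynomial (Fin n) K} (hp : p ∈ Ideal.span (g '' Set.Iio i)) (k : ℕ) :
      weightedHomogeneousComponent w k p ∈ Ideal.span (g '' Set.Iio i) :=
    weightedHomogeneousComponent_mem_span hg hp k
  rw [← sum_weightedHomogeneousComponent w h,
    finsum_eq_sum _ (weightedHomogeneousComponent_finsupp h)]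
  refine Ideal.sum_mem _ fun k _ => ?_
  set q := weightedHomogeneousComponent w k h with hq
  have hqk : IsWeightedHomogeneous w q k := weightedHomogeneousComponent_isWeightedHomogeneous k h
  have hmemq : g i * q ∈ Ideal.span (g '' Set.Iio i) := by
    have := hcomp hmem (c i + k)
    rwa [weightedHomogeneousComponent_mul_of_le (hg i) _ (Nat.le_add_right _ _),
      Nat.add_sub_cancel_left] at this
  have hloc : algebraMap _ L q ∈ (Ideal.span (g '' Set.Iio i)).map (algebraMap _ L) := by
    have := hL i (algebraMap _ L q)
    rw [hspan, Function.comp_apply, ← map_mul] at this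
    exact this (Ideal.mem_map_of_mem _ hmemq)
  rw [IsLocalization.algebraMap_mem_map_algebraMap_iff 𝔪.primeCompl] at hloc
  obtain ⟨s, hs, hsq⟩ := hloc
  have hs0 : coeff 0 s ≠ 0 := fun h0 => hs h0
  have h0 := hcomp hsq k
  rw [mul_comm, weightedHomogeneousComponent_mul_of_le hqk _ le_rfl, Nat.sub_self,
    weightedHomogeneousComponent_zero _ (fun i => (hw i).ne'), mul_comm] at h0
  exact (Ideal.unit_mul_mem_iff_mem _ ((IsUnit.mk0 _ hs0).map C)).mp h0

/-- The image of the weighted homogeneous polynomials of degree `k` in the quotient by `I`. -/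
noncomputable def quotientPiece (w : Fin n → ℕ) (I : Ideal (MvPolynomial (Fin n) K)) (k : ℕ) :
    Submodule K (MvPolynomial (Fin n) K ⧸ I) :=
  (weightedHomogeneousSubmodule K w k).map (Ideal.Quotient.mkₐ K I).toLinearMap

theorem mem_quotientPiece {I : Ideal (MvPolynomial (Fin n) K)} {k : ℕ}
    {x : MvPolynomial (Fin n) K ⧸ I} :
    x ∈ quotientPiece w I k ↔ ∃ q, IsWeightedHomogeneous w q k ∧ Ideal.Quotient.mk I q = x :=
  Iff.rfl

theorem finiteDimensional_quotientPiece (hw : ∀ i, 0 < w i)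
    (I : Ideal (MvPolynomial (Fin n) K)) (k : ℕ) :
    FiniteDimensional K (quotientPiece w I k) :=
  Module.Finite.iff_fg.mpr
    ((weightedHomogeneousSubmodule_fg K w (fun i => (hw i).ne') k).map _)

/-- The Hilbert series of the quotient by `I` with respect to the weights `w`. -/
noncomputable def hilbertSeries (w : Fin n → ℕ) (I : Ideal (MvPolynomial (Fin n) K)) :
    PowerSeries ℤ :=
  .mk fun k => (Module.finrank K (quotientPiece w I k) : ℤ)

theorem Submodule.finrank_map_add_finrank_inf_ker {V V₂ : Type*} [AddCommGroup V]
    [Module K V] [AddCommGroup V₂] [Module K V₂] (f : V →ₗ[K] V₂) (p : Submodule K V)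
    [FiniteDimensional K p] :
    Module.finrank K (p.map f) + Module.finrank K (p ⊓ LinearMap.ker f : Submodule K V) =
      Module.finrank K p := by
  rw [← LinearMap.finrank_range_add_finrank_ker (f.domRestrict p), LinearMap.range_domRestrict,
    LinearMap.ker_domRestrict, ← Submodule.finrank_map_subtype_eq, Submodule.map_comap_subtype]

theorem hilbertSeries_sup_span_singleton (hw : ∀ i, 0 < w i)
    {I : Ideal (MvPolynomial (Fin n) K)}
    (hI : ∀ p ∈ I, ∀ k, weightedHomogeneousComponent w k p ∈ I)
    {p : MvPolynomial (Fin n) K} {c : ℕ} (hp : IsWeightedHomogeneous w p c)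
    (hreg : ∀ h, p * h ∈ I → h ∈ I) :
    hilbertSeries w (I ⊔ Ideal.span {p}) = (1 - PowerSeries.X ^ c) * hilbertSeries w I := by
  ext k
  set ψ := (Ideal.Quotient.factorₐ K (le_sup_left : I ≤ I ⊔ Ideal.span {p})).toLinearMap with hψ
  have hmap : quotientPiece w (I ⊔ Ideal.span {p}) k = (quotientPiece w I k).map ψ := by
    rw [quotientPiece, quotientPiece, ← Submodule.map_comp]
    rfl
  have := finiteDimensional_quotientPiece hw I k
  have hrank := Submodule.finrank_map_add_finrank_inf_ker ψ (quotientPiece w I k)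
  rw [← hmap] at hrank
  have hker {q : MvPolynomial (Fin n) K} (hq : IsWeightedHomogeneous w q k)
      (h : ψ (Ideal.Quotient.mk I q) = 0) :
      ∃ r, q - weightedHomogeneousComponent w k (p * r) ∈ I := by
    have hmem : q ∈ I ⊔ Ideal.span {p} := Ideal.Quotient.eq_zero_iff_mem.mp h
    obtain ⟨a, ha, b, hb, rfl⟩ := Submodule.mem_sup.mp hmem
    obtain ⟨r, rfl⟩ := Ideal.mem_span_singleton'.mp hb
    refine ⟨r, ?_⟩
    have := hI a ha k
    rwa [← hq.weightedHomogeneousComponent_same, map_add, mul_comm, add_sub_cancel_right]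
  rw [sub_mul, one_mul, map_sub, PowerSeries.coeff_X_pow_mul']
  simp only [hilbertSeries, PowerSeries.coeff_mk]
  split_ifs with hck
  · have hinf : quotientPiece w I k ⊓ LinearMap.ker ψ =
        (quotientPiece w I (k - c)).map (LinearMap.mulLeft K (Ideal.Quotient.mk I p)) := by
      ext x
      simp only [Submodule.mem_inf, mem_quotientPiece, Submodule.mem_map, LinearMap.mem_ker]
      constructor
      · rintro ⟨⟨q, hq, rfl⟩, hx⟩
        obtain ⟨r, hr⟩ := hker hq hx
        rw [weightedHomogeneousComponent_mul_of_le hp _ hck] at hr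
        refine ⟨_, ⟨_, weightedHomogeneousComponent_isWeightedHomogeneous _ r, rfl⟩, ?_⟩
        rw [LinearMap.mulLeft_apply, ← map_mul]
        exact (Ideal.Quotient.eq.mpr hr).symm
      · rintro ⟨_, ⟨q, hq, rfl⟩, rfl⟩
        refine ⟨⟨p * q, ?_, map_mul _ _ _⟩, ?_⟩
        · simpa [hck] using hp.mul hq
        · rw [LinearMap.mulLeft_apply, ← map_mul]
          exact Ideal.Quotient.eq_zero_iff_mem.mpr
            (Ideal.mem_sup_right (Ideal.mul_mem_right _ _ (Ideal.mem_span_singleton_self p)))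
    have hinj : Function.Injective (LinearMap.mulLeft K (Ideal.Quotient.mk I p)) := by
      rw [injective_iff_map_eq_zero]
      intro x hx
      obtain ⟨q, rfl⟩ := Ideal.Quotient.mk_surjective x
      rw [LinearMap.mulLeft_apply, ← map_mul, Ideal.Quotient.eq_zero_iff_mem] at hx
      exact Ideal.Quotient.eq_zero_iff_mem.mpr (hreg q hx)
    rw [hinf, ← (Submodule.equivMapOfInjective _ hinj _).finrank_eq] at hrank
    omega
  · have hinf : quotientPiece w I k ⊓ LinearMap.ker ψ = ⊥ := by
      rw [eq_bot_iff]
      rintro _ ⟨⟨q, hq, rfl⟩, hx⟩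
      obtain ⟨r, hr⟩ := hker hq hx
      rw [weightedHomogeneousComponent_mul_of_lt hp _ (not_le.mp hck), sub_zero] at hr
      exact Ideal.Quotient.eq_zero_iff_mem.mpr hr
    rw [hinf, finrank_bot] at hrank
    omega

theorem hilbertSeries_span_range (hw : ∀ i, 0 < w i)
    {g : Fin n → MvPolynomial (Fin n) K} {c : Fin n → ℕ}
    (hg : ∀ i, IsWeightedHomogeneous w (g i) (c i))
    (hreg : ∀ i h, g i * h ∈ Ideal.span (g '' Set.Iio i) → h ∈ Ideal.span (g '' Set.Iio i)) :
    hilbertSeries w (Ideal.span (Set.range g)) =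
      (∏ i, (1 - PowerSeries.X ^ c i)) * hilbertSeries w (⊥ : Ideal (MvPolynomial (Fin n) K)) := by
  have key (j : ℕ) (hj : j ≤ n) : hilbertSeries w (Ideal.span (g '' {i | i.val < j})) =
      (∏ i with i.val < j, (1 - PowerSeries.X ^ c i)) *
        hilbertSeries w (⊥ : Ideal (MvPolynomial (Fin n) K)) := by
    induction j with
    | zero => simp
    | succ j ih =>
      have hset : {i : Fin n | i.val < j + 1} = insert ⟨j, hj⟩ {i | i.val < j} := by
        ext i
        simp [Fin.ext_iff]
        omega
      have hfin : ({i | i.val < j + 1} : Finset (Fin n)) =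
          insert ⟨j, hj⟩ ({i | i.val < j} : Finset (Fin n)) := by
        ext i
        simp [Fin.ext_iff]
        omega
      rw [hset, hfin, Set.image_insert_eq, Ideal.span_insert, sup_comm,
        hilbertSeries_sup_span_singleton (I := Ideal.span (g '' {i | i.val < j})) hw
          (fun p hp k => weightedHomogeneousComponent_mem_span hg hp k) (hg _) (hreg ⟨j, hj⟩),
        ih (by omega), Finset.prod_insert (by simp), mul_assoc]
  simpa using key n le_rfl

theorem hilbertSeries_span_range_X (hw : ∀ i, 0 < w i) :
    hilbertSeries w (Ideal.span (Set.range (X : Fin n → MvPolynomial (Fin n) K))) = 1 := by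
  ext k
  rw [hilbertSeries, PowerSeries.coeff_mk, PowerSeries.coeff_one, span_range_X_eq_ker_constantCoeff]
  split_ifs with hk
  · subst hk
    have : quotientPiece w (RingHom.ker (constantCoeff (R := K) (σ := Fin n))) 0 = K ∙ 1 := by
      ext x
      rw [mem_quotientPiece, Submodule.mem_span_singleton]
      constructor
      · rintro ⟨q, hq, rfl⟩
        have hC := hq.weightedHomogeneousComponent_same
        rw [weightedHomogeneousComponent_zero _ (fun i => (hw i).ne')] at hC
        refine ⟨coeff 0 q, ?_⟩
        rw [Algebra.smul_def, mul_one, ← hC, coeff_C, if_pos rfl]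
        rfl
      · rintro ⟨a, rfl⟩
        refine ⟨C a, isWeightedHomogeneous_C w a, ?_⟩
        rw [Algebra.smul_def, mul_one]
        rfl
    have hne : (1 : MvPolynomial (Fin n) K ⧸
        RingHom.ker (constantCoeff (R := K) (σ := Fin n))) ≠ 0 := by
      rw [← map_one (Ideal.Quotient.mk _), ne_eq, Ideal.Quotient.eq_zero_iff_mem]
      simp
    rw [this, finrank_span_singleton hne, Nat.cast_one]
  · have : quotientPiece w (RingHom.ker (constantCoeff (R := K) (σ := Fin n))) k = ⊥ := by
      rw [eq_bot_iff]
      rintro _ ⟨q, hq, rfl⟩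
      exact Ideal.Quotient.eq_zero_iff_mem.mpr
        (constantCoeff_eq_zero_of_isWeightedHomogeneous hq (Nat.pos_of_ne_zero hk))
    rw [this, finrank_bot, Nat.cast_zero]

theorem exists_X_pow_mem (hw : ∀ i, 0 < w i) {I : Ideal (MvPolynomial (Fin n) K)}
    (hI : ∀ p ∈ I, ∀ k, weightedHomogeneousComponent w k p ∈ I)
    [FiniteDimensional K (MvPolynomial (Fin n) K ⧸ I)] (i : Fin n) : ∃ N, X i ^ N ∈ I := by
  obtain ⟨P, hP, hroot⟩ := Algebra.IsIntegral.isIntegral (R := K) (Ideal.Quotient.mk I (X i))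
  have hmem : Polynomial.aeval (X i) P ∈ I := by
    rw [← Ideal.Quotient.eq_zero_iff_mem, ← Ideal.Quotient.mkₐ_eq_mk K,
      ← Polynomial.aeval_algHom_apply]
    exact hroot
  refine ⟨P.natDegree, ?_⟩
  have hcomp := hI _ hmem (P.natDegree * w i)
  have hhom (j : ℕ) : IsWeightedHomogeneous w (P.coeff j • X i ^ j : MvPolynomial (Fin n) K)
      (j * w i) := by
    rw [smul_eq_C_mul]
    simpa using ((isWeightedHomogeneous_X K w i).pow j).C_mul (P.coeff j)
  rw [Polynomial.aeval_eq_sum_range, map_sum, Finset.sum_eq_single P.natDegree,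
    (hhom _).weightedHomogeneousComponent_same, hP.coeff_natDegree, one_smul] at hcomp
  · exact hcomp
  · intro j _ hj
    refine (hhom j).weightedHomogeneousComponent_ne _ fun h => hj ?_
    exact (Nat.eq_of_mul_eq_mul_right (hw i) h).symm
  · simp

theorem exists_forall_quotientPiece_eq_bot {I : Ideal (MvPolynomial (Fin n) K)}
    (hX : ∀ i : Fin n, ∃ N, X i ^ N ∈ I) : ∃ B, ∀ k, B < k → quotientPiece w I k = ⊥ := by
  choose N hN using hX
  refine ⟨∑ i, N i * w i, fun k hk => ?_⟩
  rw [eq_bot_iff]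
  rintro _ ⟨q, hq, rfl⟩
  refine Ideal.Quotient.eq_zero_iff_mem.mpr ?_
  rw [as_sum q]
  refine Ideal.sum_mem _ fun m hm => ?_
  obtain ⟨i, hi⟩ : ∃ i, N i ≤ m i := by
    by_contra! hlt
    have hwt : Finsupp.weight w m = k := hq (mem_support_iff.mp hm)
    rw [Finsupp.weight_apply, Finsupp.sum_fintype _ _ (by simp)] at hwt
    refine hk.not_ge (hwt ▸ Finset.sum_le_sum fun i _ => ?_)
    exact Nat.mul_le_mul_right _ (hlt i).le
  have hmono : monomial m (coeff m q) =
      X i ^ N i * monomial (m - Finsupp.single i (N i)) (coeff m q) := by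
    rw [X_pow_eq_monomial, monomial_mul, one_mul, add_tsub_cancel_of_le (by simpa using hi)]
  rw [hmono]
  exact Ideal.mul_mem_right _ _ (hN i)

open Polynomial in
theorem Polynomial.reverse_one_sub_X_pow (c : ℕ) :
    (1 - X ^ c : ℤ[X]).reverse = -(1 - X ^ c) := by
  have hdeg : (1 - X ^ c : ℤ[X]).natDegree = c := by
    rw [← neg_sub, natDegree_neg, ← C_1, natDegree_X_pow_sub_C]
  rw [reverse, hdeg, reflect_sub, reflect_one, reflect_monomial, revAt_le le_rfl, Nat.sub_self,
    pow_zero, neg_sub]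

open Polynomial in
theorem Polynomial.reverse_prod {ι R : Type*} [CommRing R] [IsDomain R] (s : Finset ι)
    (p : ι → R[X]) :
    (∏ i ∈ s, p i).reverse = ∏ i ∈ s, (p i).reverse := by
  classical
  induction s using Finset.induction_on with
  | empty => rw [Finset.prod_empty, Finset.prod_empty, ← C_1, reverse_C]
  | insert i s hi ih =>
    rw [Finset.prod_insert hi, Finset.prod_insert hi, reverse_mul_of_domain, ih]

open Polynomial in
theorem Polynomial.reverse_and_natDegree_prod_one_sub_X_pow {ι : Type*} [Fintype ι]
    {c : ι → ℕ} (hc : ∀ i, 0 < c i) :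
    (∏ i, (1 - X ^ c i) : ℤ[X]).reverse = (-1) ^ Fintype.card ι * ∏ i, (1 - X ^ c i) ∧
    (∏ i, (1 - X ^ c i) : ℤ[X]) ≠ 0 ∧
    (∏ i, (1 - X ^ c i) : ℤ[X]).natDegree = ∑ i, c i := by
  have hdeg (i) : (1 - X ^ c i : ℤ[X]).natDegree = c i := by
    rw [← neg_sub, natDegree_neg, ← C_1, natDegree_X_pow_sub_C]
  have hne (i) : (1 - X ^ c i : ℤ[X]) ≠ 0 := by
    intro h
    have := hdeg i
    rw [h, natDegree_zero] at this
    exact (hc i).ne this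
  refine ⟨?_, Finset.prod_ne_zero_iff.mpr fun i _ => hne i, ?_⟩
  · rw [reverse_prod, Finset.prod_congr rfl fun i _ => reverse_one_sub_X_pow (c i),
      Finset.prod_neg, Finset.card_univ]
  · rw [natDegree_prod _ _ fun i _ => hne i]
    simp [hdeg]

/-- The Hilbert function of a graded complete intersection of dimension zero is symmetric. -/
theorem finrank_quotientPiece_symm [Infinite K] (hw : ∀ i, 0 < w i)
    {g : Fin n → MvPolynomial (Fin n) K} {c : Fin n → ℕ} (hc : ∀ i, 0 < c i)
    (hg : ∀ i, IsWeightedHomogeneous w (g i) (c i))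
    [FiniteDimensional K (MvPolynomial (Fin n) K ⧸ Ideal.span (Set.range g))]
    {k : ℕ} (hk : k ≤ ∑ i, c i - ∑ i, w i) :
    Module.finrank K (quotientPiece w (Ideal.span (Set.range g)) k) =
      Module.finrank K (quotientPiece w (Ideal.span (Set.range g))
        (∑ i, c i - ∑ i, w i - k)) := by
  set I := Ideal.span (Set.range g) with hI
  have hcomp (p) (hp : p ∈ I) (k : ℕ) : weightedHomogeneousComponent w k p ∈ I := by
    rw [hI, ← Set.image_univ] at hp ⊢
    exact weightedHomogeneousComponent_mem_span hg hp k
  have hX := exists_X_pow_mem hw hcomp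
  have hrad : RingHom.ker (constantCoeff (R := K) (σ := Fin n)) ≤ I.radical := by
    rw [← span_range_X_eq_ker_constantCoeff, Ideal.span_le]
    rintro _ ⟨i, rfl⟩
    exact hX i
  have hseries := hilbertSeries_span_range hw hg (mem_span_image_Iio_of_mul_mem hw hc hg hrad)
  have hseriesX := hilbertSeries_span_range (K := K) hw (isWeightedHomogeneous_X K w) fun i h =>
    (X_mul_mem_span_X_image_iff Set.self_notMem_Iio h).mp
  rw [hilbertSeries_span_range_X hw] at hseriesX
  obtain ⟨B, hB⟩ := exists_forall_quotientPiece_eq_bot (w := w) hX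
  set P : Polynomial ℤ := (hilbertSeries w I).trunc (B + 1) with hP
  have hPcoeff (k : ℕ) : P.coeff k = Module.finrank K (quotientPiece w I k) := by
    rw [hP, PowerSeries.coeff_trunc, hilbertSeries, PowerSeries.coeff_mk]
    split_ifs with h
    · rfl
    · rw [hB k (by omega), finrank_bot, Nat.cast_zero]
  have hPseries : (P : PowerSeries ℤ) = hilbertSeries w I := by
    ext k
    rw [Polynomial.coeff_coe, hPcoeff, hilbertSeries, PowerSeries.coeff_mk]
  have hprod : P * ∏ i, (1 - Polynomial.X ^ w i) = ∏ i, (1 - Polynomial.X ^ c i) := by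
    have hcoe (a : Fin n → ℕ) : ((∏ i, (1 - Polynomial.X ^ a i) : Polynomial ℤ) : PowerSeries ℤ) =
        ∏ i, (1 - PowerSeries.X ^ a i) := by
      simp only [← Polynomial.coeToPowerSeries.ringHom_apply, map_prod, map_sub, map_one, map_pow]
      simp [Polynomial.coeToPowerSeries.ringHom_apply]
    apply Polynomial.coe_injective
    rw [Polynomial.coe_mul, hPseries, hcoe, hcoe, hseries, mul_assoc,
      mul_comm (hilbertSeries w ⊥), ← hseriesX, mul_one]
  obtain ⟨hrevw, hnew, hdegw⟩ := Polynomial.reverse_and_natDegree_prod_one_sub_X_pow hw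
  obtain ⟨hrevc, hnec, hdegc⟩ := Polynomial.reverse_and_natDegree_prod_one_sub_X_pow hc
  have hrev : P.reverse = P := by
    have h := congrArg Polynomial.reverse hprod
    rw [Polynomial.reverse_mul_of_domain, hrevw, hrevc, ← hprod, mul_left_comm] at h
    exact mul_right_cancel₀ hnew (mul_left_cancel₀ (by simp) h)
  have hdeg : P.natDegree = ∑ i, c i - ∑ i, w i := by
    have hP0 : P ≠ 0 := fun h => hnec (by rw [← hprod, h, zero_mul])
    have h := congrArg Polynomial.natDegree hprod
    rw [Polynomial.natDegree_mul hP0 hnew, hdegw, hdegc] at h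
    omega
  have h := congrArg (Polynomial.coeff · k) hrev
  simp only [Polynomial.coeff_reverse] at h
  rw [hdeg, Polynomial.revAt_le hk, hPcoeff, hPcoeff] at h
  exact_mod_cast h.symm

end WeightedHilbert

/-- For a weighted homogeneous polynomial `f` of degree `d` (weights `w i`,
`2 w i ≤ d`) with an isolated singularity at `0`, the Hilbert function of the graded Milnor
algebra is symmetric about half the socle degree: for `0 ≤ k ≤ n·d − 2·Σᵢ wᵢ`,
`dim_ℂ Q_k = dim_ℂ Q_{(n·d − 2·Σᵢ wᵢ) − k}`. -/
theorem stmt6 (n : ℕ) (hn : 1 ≤ n) (d : ℕ) (w : Fin n → ℕ)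
    (hd : 0 < d) (hw : ∀ i, 0 < w i) (hwd : ∀ i, 2 * w i ≤ d)
    (f : MvPolynomial (Fin n) ℂ)
    (hf : MvPolynomial.IsWeightedHomogeneous w f d)
    (hiso : FiniteDimensional ℂ (MvPolynomial (Fin n) ℂ ⧸ jacobianIdeal n f)) :
    ∀ k : ℕ, k ≤ n * d - 2 * ∑ i, w i →
      Module.finrank ℂ (milnorPiece n w f k) =
        Module.finrank ℂ (milnorPiece n w f ((n * d - 2 * ∑ i, w i) - k)) := by
  have hsum : ∑ i, (d - w i) - ∑ i, w i = n * d - 2 * ∑ i, w i := by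
    rw [Finset.sum_tsub_distrib _ fun i _ => by linarith [hwd i]]
    simp only [Finset.sum_const, Finset.card_univ, Fintype.card_fin, smul_eq_mul]
    omega
  intro k hk
  rw [← hsum] at hk ⊢
  have : FiniteDimensional ℂ
      (MvPolynomial (Fin n) ℂ ⧸ Ideal.span (Set.range fun i => pderiv i f)) := hiso
  refine finrank_quotientPiece_symm hw (c := fun i => d - w i) (fun i => ?_) (fun i => ?_) hk
  · have := hw i
    have := hwd i
    omega
  · exact hf.pderiv (Nat.sub_add_cancel (by linarith [hwd i]))
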